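/- (Sanov's theorem.) Let X be a Polish space, let Q be a Borel probability measure on X, and let x_1, x_2, … be i.i.d. with law Q, with empirical measures Q̂_n = (1/n)∑_{i=1}^n δ_{x_i}. Then for every set Γ ⊆ P(X): limsup_{n→∞} −(1/n) log Prob(Q̂_n ∈ Γ) ≤ inf_{R ∈ int Γ} D(R‖Q), and liminf_{n→∞} −(1/n) log Prob(Q̂_n ∈ Γ) ≥ inf_{R ∈ cl Γ} D(R‖Q), where int Γ and cl Γ denote the interior and closure of Γ with respect to the topology of weak convergence on P(X). -/

import Mathlib

open MeasureTheory Filter Topology ENNReal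
open scoped Classical

noncomputable section
/-- The Kullback-Leibler divergence `D(P‖Q) ∈ [0,∞]`: it equals `∫ log (dP/dQ) dP` when
`P ≪ Q` (and the integral is well defined), and `+∞` otherwise. -/
def klDiv {X : Type*} [MeasurableSpace X] (P Q : Measure X) : ℝ≥0∞ :=
  if P ≪ Q ∧ Integrable (llr P Q) P then ENNReal.ofReal (∫ x, llr P Q x ∂P) else ⊤
/-- The empirical measure `(1/n) ∑_{i<n} δ_{x i}` of a sample, as a probability measure
(junk value for `n = 0`). -/
def empMeas {X : Type*} [MeasurableSpace X] [Nonempty X] (n : ℕ) (x : Fin n → X) :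
    ProbabilityMeasure X :=
  if h : 0 < n then
    ⟨(n : ℝ≥0∞)⁻¹ • ∑ i, Measure.dirac (x i), by
      constructor
      simp only [Measure.smul_apply, smul_eq_mul, Measure.coe_finset_sum, Finset.sum_apply,
        measure_univ, Finset.sum_const, Finset.card_univ, Fintype.card_fin, nsmul_eq_mul, mul_one]
      exact ENNReal.inv_mul_cancel (by exact_mod_cast h.ne') (by simp)⟩
  else ⟨Measure.dirac (Classical.arbitrary X), inferInstance⟩
/-- The exponential decay rate `-(1/n) log p` of a probability `p`, valued in `EReal`
(with `-(1/n) log 0 = ⊤`). -/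
def expRate (n : ℕ) (p : ℝ≥0∞) : EReal := -((((n : ℝ)⁻¹ : ℝ) : EReal) * ENNReal.log p)

section KullbackLeibler

variable {α : Type*} [MeasurableSpace α]

lemma klDiv_eq_informationTheory_klDiv (μ ν : Measure α) [IsProbabilityMeasure μ]
    [IsProbabilityMeasure ν] : klDiv μ ν = InformationTheory.klDiv μ ν := by
  simp [klDiv, InformationTheory.klDiv]

lemma informationTheory_klDiv_prod_le {β : Type*} [MeasurableSpace β] (μ ν : Measure α)
    (μ' ν' : Measure β) [IsProbabilityMeasure μ] [IsProbabilityMeasure ν]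
    [IsProbabilityMeasure μ'] [IsProbabilityMeasure ν'] :
    InformationTheory.klDiv (μ.prod μ') (ν.prod ν')
      ≤ InformationTheory.klDiv μ ν + InformationTheory.klDiv μ' ν' := by
  rw [← Measure.compProd_const, ← Measure.compProd_const,
    InformationTheory.klDiv_compProd_eq_add, Measure.compProd_const, Measure.compProd_const,
    ← Measure.prod_swap (μ := μ') (ν := μ), ← Measure.prod_swap (μ := ν') (ν := μ)]
  gcongr
  refine (InformationTheory.klDiv_map_le _ _ measurable_swap).trans ?_
  rw [← Measure.compProd_const, ← Measure.compProd_const,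
    InformationTheory.klDiv_compProd_left]

lemma informationTheory_klDiv_pi_le (μ ν : Measure α) [IsProbabilityMeasure μ]
    [IsProbabilityMeasure ν] (n : ℕ) :
    InformationTheory.klDiv (Measure.pi fun _ : Fin n => μ) (Measure.pi fun _ : Fin n => ν)
      ≤ n * InformationTheory.klDiv μ ν := by
  induction n with
  | zero =>
    rw [Measure.pi_of_empty _ Fin.elim0, Measure.pi_of_empty _ Fin.elim0]
    simp
  | succ n ih =>
    have hμ := (measurePreserving_piFinSuccAbove (fun _ : Fin (n + 1) => μ) 0).symm
    have hν := (measurePreserving_piFinSuccAbove (fun _ : Fin (n + 1) => ν) 0).symm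
    rw [← hμ.map_eq, ← hν.map_eq]
    refine (InformationTheory.klDiv_map_le _ _ (MeasurableEquiv.measurable _)).trans ?_
    refine (informationTheory_klDiv_prod_le _ _ _ _).trans ?_
    push_cast
    rw [add_mul, one_mul, add_comm]
    gcongr

lemma mul_sub_exp_add_one_le_klFun {x : ℝ} (hx : 0 ≤ x) (t : ℝ) :
    x * t - Real.exp t + 1 ≤ InformationTheory.klFun x := by
  rcases hx.eq_or_lt with rfl | hx
  · simp [InformationTheory.klFun, Real.exp_nonneg]
  · have h := mul_le_mul_of_nonneg_left (Real.add_one_le_exp (t - Real.log x)) hx.le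
    rw [Real.exp_sub, Real.exp_log hx, mul_div_cancel₀ _ hx.ne'] at h
    simp only [InformationTheory.klFun]
    linarith

/-- A finite divergence `D(μ‖ν)` prevents the `ν`-probability of an event from being much smaller
than its `μ`-probability. -/
lemma pos_and_neg_log_le_of_klDiv_ne_top {μ ν : Measure α} [IsProbabilityMeasure μ]
    [IsProbabilityMeasure ν] (h : InformationTheory.klDiv μ ν ≠ ∞) {s : Set α}
    (hμs : 0 < μ.real s) :
    0 < ν.real s ∧
      -Real.log (ν.real s) ≤ ((InformationTheory.klDiv μ ν).toReal + 1) / μ.real s := by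
  obtain ⟨hac, hint⟩ := InformationTheory.klDiv_ne_top_iff.1 h
  have hνs : 0 < ν.real s := by
    refine (measureReal_nonneg).lt_of_ne' fun h0 => hμs.ne' ?_
    rw [measureReal_eq_zero_iff] at h0 ⊢
    exact hac h0
  refine ⟨hνs, ?_⟩
  set t := -Real.log (ν.real s) with ht
  have hexp : Real.exp t * ν.real s = 1 := by
    rw [ht, Real.exp_neg, Real.exp_log hνs, inv_mul_cancel₀ hνs.ne']
  have hkl := (InformationTheory.integrable_klFun_rnDeriv_iff hac).2 hint
  have hd : Integrable (fun x => (μ.rnDeriv ν x).toReal) ν := Measure.integrable_toReal_rnDeriv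
  have key : μ.real s * t - Real.exp t * ν.real s + ν.real s
      ≤ (InformationTheory.klDiv μ ν).toReal := by
    rw [InformationTheory.toReal_klDiv_eq_integral_klFun hac]
    calc μ.real s * t - Real.exp t * ν.real s + ν.real s
        = ∫ x in s, ((μ.rnDeriv ν x).toReal * t - Real.exp t + 1) ∂ν := by
          have hd' : Integrable (fun x => (μ.rnDeriv ν x).toReal * t) (ν.restrict s) :=
            (hd.mul_const t).restrict
          rw [integral_add (by fun_prop) (integrable_const _),
            integral_sub hd' (integrable_const _), integral_mul_const,
            Measure.setIntegral_toReal_rnDeriv hac]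
          simp [mul_comm]
      _ ≤ ∫ x in s, InformationTheory.klFun (μ.rnDeriv ν x).toReal ∂ν := by
          refine integral_mono ?_ hkl.restrict
            fun x => mul_sub_exp_add_one_le_klFun ENNReal.toReal_nonneg t
          exact (((hd.mul_const t).sub (integrable_const _)).add (integrable_const _)).restrict
      _ ≤ ∫ x, InformationTheory.klFun (μ.rnDeriv ν x).toReal ∂ν :=
          setIntegral_le_integral hkl
            (.of_forall fun x => InformationTheory.klFun_nonneg ENNReal.toReal_nonneg)
  rw [le_div_iff₀ hμs]
  linarith

end KullbackLeibler

section EmpiricalMeasure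

variable {X : Type*} [MeasurableSpace X]

lemma integral_empMeas [Nonempty X] {n : ℕ} (hn : 0 < n) (x : Fin n → X) {g : X → ℝ}
    (hg : StronglyMeasurable g) :
    ∫ y, g y ∂(empMeas n x : Measure X) = (n : ℝ)⁻¹ * ∑ i, g (x i) := by
  have h : (empMeas n x : Measure X) = (n : ℝ≥0∞)⁻¹ • ∑ i, Measure.dirac (x i) := by
    simp [empMeas, hn]
  rw [h, integral_smul_measure, integral_finsetSum_measure]
  · simp [integral_dirac' _ _ hg]
  · exact fun i _ => integrable_dirac' hg (by simp)

/-- Chernoff bound for the average of a bounded function under the empirical measure. -/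
lemma measure_le_integral_empMeas [Nonempty X] (Q : Measure X) [IsProbabilityMeasure Q] {g : X → ℝ}
    (hg : Measurable g) {B : ℝ} (hB : ∀ x, g x ≤ B) {n : ℕ} (hn : 0 < n) (c : ℝ) :
    Measure.pi (fun _ : Fin n => Q) {x | c ≤ ∫ y, g y ∂(empMeas n x : Measure X)}
      ≤ ENNReal.ofReal (Real.exp (-(n * c)) * (∫ y, Real.exp (g y) ∂Q) ^ n) := by
  have hint : Integrable (fun x : Fin n → X => Real.exp (1 * ∑ i, g (x i)))
      (Measure.pi fun _ => Q) := by
    refine Integrable.of_bound (Measurable.aestronglyMeasurable (by fun_prop))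
      (Real.exp (∑ _i : Fin n, B)) (.of_forall fun x => ?_)
    rw [Real.norm_eq_abs, Real.abs_exp, one_mul]
    gcongr
    exact hB _
  have h := ProbabilityTheory.measure_ge_le_exp_mul_mgf (n * c) zero_le_one hint
  have hpow : ProbabilityTheory.mgf (fun x : Fin n → X => ∑ i, g (x i))
      (Measure.pi fun _ => Q) 1 = (∫ y, Real.exp (g y) ∂Q) ^ n := by
    simp only [ProbabilityTheory.mgf, one_mul, Real.exp_sum]
    simpa using integral_fintype_prod_eq_pow (ι := Fin n) (μ := Q) (fun y => Real.exp (g y))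
  rw [hpow, neg_one_mul] at h
  have hset : {x : Fin n → X | c ≤ ∫ y, g y ∂(empMeas n x : Measure X)}
      = {x | n * c ≤ ∑ i, g (x i)} := by
    ext x
    have : (0 : ℝ) < n := by exact_mod_cast hn
    simp only [Set.mem_ofPred_eq, integral_empMeas hn x hg.stronglyMeasurable]
    rw [inv_mul_eq_div, le_div_iff₀ this, mul_comm]
  rw [hset, ← ofReal_measureReal]
  exact ENNReal.ofReal_le_ofReal h

end EmpiricalMeasure

section LawOfLargeNumbers

variable {X : Type*} [MeasurableSpace X] [Nonempty X]

lemma tendsto_measure_integral_empMeas_notMem (ρ : Measure X) [IsProbabilityMeasure ρ] {g : X → ℝ}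
    (hg : Measurable g) (hgR : Integrable g ρ) {V : Set ℝ} (hV : V ∈ 𝓝 (∫ y, g y ∂ρ)) :
    Tendsto (fun n : ℕ => Measure.pi (fun _ : Fin n => ρ)
      {x | ∫ y, g y ∂(empMeas n x : Measure X) ∉ V}) atTop (𝓝 0) := by
  obtain ⟨ε, hε, hball⟩ := Metric.mem_nhds_iff.1 hV
  set P : Measure (ℕ → X) := Measure.infinitePi fun _ => ρ
  have heval (i : ℕ) : MeasurePreserving (fun ω : ℕ → X => ω i) P ρ :=
    measurePreserving_eval_infinitePi (fun _ : ℕ => ρ) i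
  have hmean : ∫ ω, g (ω 0) ∂P = ∫ y, g y ∂ρ := by
    rw [← (heval 0).map_eq, integral_map (heval 0).measurable.aemeasurable
      hg.aestronglyMeasurable]
  have hlaw := ProbabilityTheory.strong_law_ae_real (μ := P) (fun i ω => g (ω i))
    ((heval 0).integrable_comp_of_integrable hgR)
    (fun i j hij => (ProbabilityTheory.iIndepFun_infinitePi (P := fun _ : ℕ => ρ)
      (X := fun _ => g) fun _ => hg).indepFun hij)
    (fun i => by
      refine ⟨Measurable.aemeasurable (by fun_prop), Measurable.aemeasurable (by fun_prop), ?_⟩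
      have h (j : ℕ) : P.map (fun ω => g (ω j)) = ρ.map g := by
        rw [← (heval j).map_eq, Measure.map_map hg (heval j).measurable]
        rfl
      rw [h, h])
  have hprob := tendstoInMeasure_of_tendsto_ae
    (fun n => Measurable.aestronglyMeasurable (by fun_prop)) hlaw
  rw [hmean, tendstoInMeasure_iff_dist] at hprob
  refine tendsto_of_tendsto_of_tendsto_of_le_of_le' tendsto_const_nhds (hprob ε hε)
    (.of_forall fun _ => zero_le) ?_
  filter_upwards [eventually_gt_atTop 0] with n hn
  have hpi : Measure.pi (fun _ : Fin n => ρ) = P.map fun ω (i : Fin n) => ω i := by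
    rw [← Measure.infinitePi_eq_pi]
    exact (Measure.map_infinitePi_infinitePi_of_inj (P := fun _ : ℕ => ρ)
      Fin.val_injective).symm
  calc Measure.pi (fun _ : Fin n => ρ) {x | ∫ y, g y ∂(empMeas n x : Measure X) ∉ V}
      ≤ Measure.pi (fun _ : Fin n => ρ)
          {x | ε ≤ dist ((∑ i, g (x i)) / (n : ℝ)) (∫ y, g y ∂ρ)} := by
        refine measure_mono fun x hx => ?_
        rw [Set.mem_ofPred_eq, integral_empMeas hn x hg.stronglyMeasurable,
          inv_mul_eq_div] at hx
        exact not_lt.1 fun h => hx (hball (Metric.mem_ball.2 h))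
    _ = P {ω | ε ≤ dist ((∑ i ∈ Finset.range n, g (ω i)) / (n : ℝ)) (∫ y, g y ∂ρ)} := by
        rw [hpi, Measure.map_apply (by fun_prop)
          (measurableSet_le measurable_const (by fun_prop))]
        simp only [Set.preimage_ofPred_eq, Finset.sum_range]

/-- The empirical measures of an i.i.d. sample converge in probability to its law. -/
lemma tendsto_measure_empMeas_notMem [TopologicalSpace X] [OpensMeasurableSpace X]
    (ρ : ProbabilityMeasure X) {U : Set (ProbabilityMeasure X)} (hU : U ∈ 𝓝 ρ) :
    Tendsto (fun n : ℕ => Measure.pi (fun _ : Fin n => (ρ : Measure X)) {x | empMeas n x ∉ U})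
      atTop (𝓝 0) := by
  let F : Filter (ProbabilityMeasure X) :=
    { sets := {S | Tendsto (fun n : ℕ => Measure.pi (fun _ : Fin n => (ρ : Measure X))
        {x | empMeas n x ∉ S}) atTop (𝓝 0)}
      univ_sets := by simp
      sets_of_superset := fun {S T} hS hST =>
        tendsto_of_tendsto_of_tendsto_of_le_of_le tendsto_const_nhds hS (fun _ => zero_le)
          fun n => measure_mono fun x hx hxS => hx (hST hxS)
      inter_sets := fun {S T} hS hT => by
        have h := Tendsto.add hS hT
        rw [add_zero] at h
        refine tendsto_of_tendsto_of_tendsto_of_le_of_le tendsto_const_nhds h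
          (fun _ => zero_le) fun n => ?_
        refine (measure_mono fun x hx => ?_).trans (measure_union_le _ _)
        simpa [imp_iff_not_or] using hx }
  have hF : Tendsto (fun S => S) F (𝓝 ρ) := by
    rw [ProbabilityMeasure.tendsto_iff_forall_integral_tendsto]
    intro g V hV
    exact tendsto_measure_integral_empMeas_notMem (ρ : Measure X) g.continuous.measurable
      (g.integrable _) hV
  exact hF hU

end LawOfLargeNumbers

section DonskerVaradhan

open BoundedContinuousFunction

variable {X : Type*} [MeasurableSpace X]

lemma integral_le_add_log_of_forall_boundedContinuous [TopologicalSpace X]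
    [TopologicalSpace.PseudoMetrizableSpace X] [BorelSpace X]
    {ρ Q : Measure X} [IsProbabilityMeasure ρ] [IsProbabilityMeasure Q] {a : ℝ}
    (h : ∀ g : X →ᵇ ℝ, ∫ x, g x ∂ρ ≤ a + Real.log (∫ x, Real.exp (g x) ∂Q))
    {g : X → ℝ} (hg : Measurable g) {B : ℝ} (hB : ∀ x, |g x| ≤ B) :
    ∫ x, g x ∂ρ ≤ a + Real.log (∫ x, Real.exp (g x) ∂Q) := by
  have hint (μ : Measure X) [IsFiniteMeasure μ] : Integrable g μ :=
    .of_bound hg.aestronglyMeasurable B (.of_forall hB)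
  have hexp : Integrable (fun x => Real.exp (g x)) Q := by
    refine .of_bound (by fun_prop) (Real.exp B) (.of_forall fun x => ?_)
    rw [Real.norm_eq_abs, Real.abs_exp]
    exact Real.exp_le_exp.2 (abs_le.1 (hB x)).2
  have hpos : 0 < ∫ x, Real.exp (g x) ∂Q := integral_exp_pos hexp
  set I := ∫ x, Real.exp (g x) ∂Q
  have hlim : Tendsto (fun ε : ℝ => ε + (a + Real.log (I + Real.exp B * ε))) (𝓝[>] 0)
      (𝓝 (0 + (a + Real.log (I + Real.exp B * 0)))) := by
    refine Tendsto.mono_left ?_ nhdsWithin_le_nhds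
    have : ContinuousAt (fun ε : ℝ => ε + (a + Real.log (I + Real.exp B * ε))) 0 := by
      refine continuousAt_id.add (continuousAt_const.add (ContinuousAt.log (by fun_prop) ?_))
      simpa using hpos.ne'
    exact this
  rw [mul_zero, add_zero, zero_add] at hlim
  refine ge_of_tendsto hlim ?_
  filter_upwards [self_mem_nhdsWithin] with ε (hε : 0 < ε)
  obtain ⟨g₁, hg₁, hg₁int⟩ := (hint (ρ + Q)).exists_boundedContinuous_integral_sub_le hε
  set g₂ : X →ᵇ ℝ := (g₁ ⊓ const X B) ⊔ const X (-B)
  have hg₂ (x : X) : g₂ x = max (min (g₁ x) B) (-B) := rfl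
  have hclose (x : X) : |g x - g₂ x| ≤ ‖g x - g₁ x‖ := by
    have := abs_le.1 (hB x)
    have h1 : g x = max (min (g x) B) (-B) := by rw [min_eq_left this.2, max_eq_left this.1]
    rw [hg₂, Real.norm_eq_abs]
    nth_rw 1 [h1]
    exact (abs_max_sub_max_le_abs _ _ _).trans (abs_inf_sub_inf_le_abs _ _ _)
  have hg₂B (x : X) : g₂ x ≤ B := by
    have := abs_le.1 (hB x)
    rw [hg₂]
    exact max_le (min_le_right _ _) (by linarith)
  have hdist : Integrable (fun x => ‖g x - g₁ x‖) (ρ + Q) := ((hint _).sub hg₁int).norm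
  have hdistR := hdist.left_of_add_measure
  have hdistQ := hdist.right_of_add_measure
  rw [integral_add_measure hdistR hdistQ] at hg₁
  have hnnR : 0 ≤ ∫ x, ‖g x - g₁ x‖ ∂ρ := integral_nonneg fun _ => norm_nonneg _
  have hnnQ : 0 ≤ ∫ x, ‖g x - g₁ x‖ ∂Q := integral_nonneg fun _ => norm_nonneg _
  have hR : ∫ x, g x ∂ρ ≤ ε + ∫ x, g₂ x ∂ρ := by
    calc ∫ x, g x ∂ρ ≤ ∫ x, (‖g x - g₁ x‖ + g₂ x) ∂ρ := by
          refine integral_mono (hint ρ) (hdistR.add (g₂.integrable ρ)) fun x => ?_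
          have := (le_abs_self _).trans (hclose x)
          simp only
          linarith
      _ = ∫ x, ‖g x - g₁ x‖ ∂ρ + ∫ x, g₂ x ∂ρ := integral_add hdistR (g₂.integrable ρ)
      _ ≤ ε + ∫ x, g₂ x ∂ρ := by linarith
  have hexp₂ : Integrable (fun x => Real.exp (g₂ x)) Q := by
    refine .of_bound (Continuous.aestronglyMeasurable (by fun_prop)) (Real.exp B)
      (.of_forall fun x => ?_)
    rw [Real.norm_eq_abs, Real.abs_exp]
    exact Real.exp_le_exp.2 (hg₂B x)
  have hQ : ∫ x, Real.exp (g₂ x) ∂Q ≤ I + Real.exp B * ε := by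
    calc ∫ x, Real.exp (g₂ x) ∂Q
        ≤ ∫ x, (Real.exp (g x) + Real.exp B * ‖g x - g₁ x‖) ∂Q := by
          refine integral_mono hexp₂ (hexp.add (hdistQ.const_mul _)) fun x => ?_
          have h1 := mul_le_mul_of_nonneg_left (Real.add_one_le_exp (g x - g₂ x))
            (Real.exp_nonneg (g₂ x))
          rw [← Real.exp_add, add_sub_cancel] at h1
          have h2 : Real.exp (g₂ x) * (g₂ x - g x) ≤ Real.exp B * ‖g x - g₁ x‖ := by
            have h3 : g₂ x - g x ≤ ‖g x - g₁ x‖ := by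
              rw [← neg_sub]
              exact (neg_le_abs _).trans (hclose x)
            calc Real.exp (g₂ x) * (g₂ x - g x)
                ≤ Real.exp (g₂ x) * ‖g x - g₁ x‖ := by gcongr
              _ ≤ Real.exp B * ‖g x - g₁ x‖ := by
                  gcongr
                  exact hg₂B x
          simp only
          linarith
      _ = I + Real.exp B * ∫ x, ‖g x - g₁ x‖ ∂Q := by
          rw [integral_add hexp (hdistQ.const_mul _), integral_const_mul]
      _ ≤ I + Real.exp B * ε := by
          gcongr
          linarith
  calc ∫ x, g x ∂ρ ≤ ε + ∫ x, g₂ x ∂ρ := hR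
    _ ≤ ε + (a + Real.log (∫ x, Real.exp (g₂ x) ∂Q)) := by
        gcongr
        exact h g₂
    _ ≤ ε + (a + Real.log (I + Real.exp B * ε)) := by
        gcongr
        exact integral_exp_pos hexp₂

lemma absolutelyContinuous_of_forall_integral_le_add_log {ρ Q : Measure X}
    [IsProbabilityMeasure ρ] [IsProbabilityMeasure Q] {a : ℝ}
    (h : ∀ g : X → ℝ, Measurable g → (∃ B, ∀ x, |g x| ≤ B) →
      ∫ x, g x ∂ρ ≤ a + Real.log (∫ x, Real.exp (g x) ∂Q)) : ρ ≪ Q := by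
  refine Measure.AbsolutelyContinuous.mk fun N hN hQN => ?_
  rw [← measureReal_eq_zero_iff]
  by_contra hRN
  set t := (a + 1) / ρ.real N
  have h1 := h (N.indicator fun _ => t) (measurable_const.indicator hN)
    ⟨|t|, fun x => by by_cases hx : x ∈ N <;> simp [hx]⟩
  have h2 : ∫ x, Real.exp (N.indicator (fun _ => t) x) ∂Q = 1 := by
    rw [integral_congr_ae (g := fun _ => 1)]
    · simp
    · filter_upwards [measure_eq_zero_iff_ae_notMem.1 hQN] with x hx
      simp [hx]
  rw [h2, integral_indicator_const _ hN, smul_eq_mul, mul_div_cancel₀ _ hRN] at h1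
  simp at h1
  linarith

/-- The hard half of the Donsker–Varadhan variational formula. -/
lemma klDiv_le_of_forall_boundedContinuous [TopologicalSpace X]
    [TopologicalSpace.PseudoMetrizableSpace X] [BorelSpace X]
    {ρ Q : Measure X} [IsProbabilityMeasure ρ] [IsProbabilityMeasure Q] {a : ℝ}
    (h : ∀ g : X →ᵇ ℝ, ∫ x, g x ∂ρ ≤ a + Real.log (∫ x, Real.exp (g x) ∂Q)) :
    klDiv ρ Q ≤ ENNReal.ofReal a := by
  have hm : ∀ g : X → ℝ, Measurable g → (∃ B, ∀ x, |g x| ≤ B) →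
      ∫ x, g x ∂ρ ≤ a + Real.log (∫ x, Real.exp (g x) ∂Q) :=
    fun g hg ⟨_, hB⟩ => integral_le_add_log_of_forall_boundedContinuous h hg hB
  have hac := absolutelyContinuous_of_forall_integral_le_add_log hm
  rw [klDiv_eq_informationTheory_klDiv, InformationTheory.klDiv_eq_lintegral_klFun_of_ac hac]
  set f : X → ℝ := fun x => (ρ.rnDeriv Q x).toReal
  have hf : Measurable f := by fun_prop
  have hf0 (x : X) : 0 ≤ f x := ENNReal.toReal_nonneg
  have hfint : Integrable f Q := Measure.integrable_toReal_rnDeriv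
  have hf1 : ∫ x, f x ∂Q = 1 := by simp [f, Measure.integral_toReal_rnDeriv hac]
  set c : ℕ → ℝ := fun k => k + 1
  have hc (k : ℕ) : 1 ≤ c k := by simp [c]
  set φ : ℕ → X → ℝ := fun k x => max (Real.exp (-c k)) (min (f x) (Real.exp (c k)))
  have hφm (k : ℕ) : Measurable (φ k) := by fun_prop
  have hφpos (k : ℕ) (x : X) : 0 < φ k x := lt_max_of_lt_left (Real.exp_pos _)
  have hφlog (k : ℕ) (x : X) : |Real.log (φ k x)| ≤ c k := by
    rw [abs_le, Real.le_log_iff_exp_le (hφpos k x), Real.log_le_iff_le_exp (hφpos k x)]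
    refine ⟨le_max_left _ _, max_le (Real.exp_le_exp.2 ?_) (min_le_right _ _)⟩
    linarith [hc k]
  have hφf (k : ℕ) (x : X) : 0 ≤ f x * Real.log (φ k x) + 1 - f x := by
    rcases le_total (f x) (Real.exp (c k)) with hx | hx
    · have h1 := InformationTheory.klFun_nonneg (hf0 x)
      rw [InformationTheory.klFun_apply] at h1
      have h2 : f x * Real.log (f x) ≤ f x * Real.log (φ k x) := by
        rcases (hf0 x).eq_or_lt with h0 | h0
        · simp [← h0]
        · gcongr
          simp [φ, hx]
      linarith
    · have h1 : Real.exp (c k) ≤ φ k x := by simp [φ, hx]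
      have h2 : 1 ≤ Real.log (φ k x) :=
        (hc k).trans ((Real.le_log_iff_exp_le (hφpos k x)).2 h1)
      nlinarith [hf0 x]
  have hφint (k : ℕ) : ∫⁻ x, ENNReal.ofReal (f x * Real.log (φ k x) + 1 - f x) ∂Q
      ≤ ENNReal.ofReal (a + Real.log (1 + Real.exp (-c k))) := by
    have hmul : Integrable (fun x => f x * Real.log (φ k x)) Q :=
      hfint.mul_bdd (c := c k) (Measurable.aestronglyMeasurable (by fun_prop))
        (.of_forall (hφlog k))
    rw [← ofReal_integral_eq_lintegral_ofReal (by fun_prop) (.of_forall (hφf k))]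
    refine ENNReal.ofReal_le_ofReal ?_
    have hsplit : ∫ x, (f x * Real.log (φ k x) + 1 - f x) ∂Q = ∫ x, Real.log (φ k x) ∂ρ := by
      rw [integral_sub (by fun_prop) hfint, integral_add hmul (integrable_const _), hf1,
        ← integral_rnDeriv_smul hac]
      simp [f]
    rw [hsplit]
    refine (hm _ (by fun_prop) ⟨c k, hφlog k⟩).trans ?_
    simp only [Real.exp_log (hφpos k _)]
    have hφle (x : X) : φ k x ≤ f x + Real.exp (-c k) := by
      refine max_le ?_ ((min_le_left _ _).trans ?_)
      · linarith [hf0 x]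
      · linarith [Real.exp_pos (-c k)]
    have hφi : Integrable (φ k) Q := by
      refine (hfint.add (integrable_const (Real.exp (-c k)))).mono'
        (hφm k).aestronglyMeasurable (.of_forall fun x => ?_)
      rw [Real.norm_of_nonneg (hφpos k x).le]
      exact hφle x
    have hle : ∫ x, φ k x ∂Q ≤ 1 + Real.exp (-c k) := by
      calc ∫ x, φ k x ∂Q ≤ ∫ x, (f x + Real.exp (-c k)) ∂Q :=
            integral_mono hφi (hfint.add (integrable_const _)) hφle
        _ = 1 + Real.exp (-c k) := by
            rw [integral_add hfint (integrable_const _), hf1]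
            simp
    have hlow : Real.exp (-c k) ≤ ∫ x, φ k x ∂Q := by
      calc Real.exp (-c k) = ∫ _x, Real.exp (-c k) ∂Q := by simp
        _ ≤ ∫ x, φ k x ∂Q := integral_mono (integrable_const _) hφi fun x => le_max_left _ _
    gcongr
    exact (Real.exp_pos _).trans_le hlow
  have hctop : Tendsto c atTop atTop :=
    tendsto_atTop_add_const_right _ _ tendsto_natCast_atTop_atTop
  have hcexp : Tendsto (fun k => Real.exp (-c k)) atTop (𝓝 0) :=
    Real.tendsto_exp_neg_atTop_nhds_zero.comp hctop
  have hφlim (x : X) : Tendsto (fun k => f x * Real.log (φ k x) + 1 - f x) atTop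
      (𝓝 (InformationTheory.klFun (f x))) := by
    rcases (hf0 x).eq_or_lt with h0 | h0
    · simp [← h0, InformationTheory.klFun_apply]
    · have h1 : Tendsto (fun k => φ k x) atTop (𝓝 (max 0 (f x))) := by
        refine hcexp.max (tendsto_const_nhds.congr' ?_)
        filter_upwards [(Real.tendsto_exp_atTop.comp hctop).eventually_ge_atTop (f x)] with k hk
        exact (min_eq_left hk).symm
      rw [max_eq_right h0.le] at h1
      exact (((h1.log h0.ne').const_mul _).add_const _).sub_const _
  have hbound : Tendsto (fun k => ENNReal.ofReal (a + Real.log (1 + Real.exp (-c k)))) atTop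
      (𝓝 (ENNReal.ofReal a)) := by
    have h1 := ((hcexp.const_add 1).log (by simp)).const_add a
    simp only [add_zero, Real.log_one] at h1
    exact ENNReal.tendsto_ofReal h1
  calc ∫⁻ x, ENNReal.ofReal (InformationTheory.klFun (f x)) ∂Q
      = ∫⁻ x, liminf (fun k => ENNReal.ofReal (f x * Real.log (φ k x) + 1 - f x)) atTop ∂Q :=
        lintegral_congr fun x => (ENNReal.tendsto_ofReal (hφlim x)).liminf_eq.symm
    _ ≤ liminf (fun k => ∫⁻ x, ENNReal.ofReal (f x * Real.log (φ k x) + 1 - f x) ∂Q) atTop :=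
        lintegral_liminf_le fun k => by fun_prop
    _ ≤ liminf (fun k => ENNReal.ofReal (a + Real.log (1 + Real.exp (-c k)))) atTop :=
        liminf_le_liminf (.of_forall hφint)
    _ = ENNReal.ofReal a := hbound.liminf_eq

end DonskerVaradhan

section Rate

lemma expRate_antitone (n : ℕ) : Antitone (expRate n) := by
  intro p q hpq
  rw [expRate, expRate, EReal.neg_le_neg_iff]
  exact mul_le_mul_of_nonneg_left (ENNReal.log_le_log hpq)
    (EReal.coe_nonneg.2 (inv_nonneg.2 n.cast_nonneg))

lemma expRate_ofReal (n : ℕ) {p : ℝ} (hp : 0 < p) :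
    expRate n (ENNReal.ofReal p) = ((-Real.log p / n : ℝ) : EReal) := by
  rw [expRate, ENNReal.log_ofReal_of_pos hp, ← EReal.coe_mul, ← EReal.coe_neg]
  congr 1
  ring

/-- An exponential upper bound on probabilities gives a lower bound on their decay rate. -/
lemma le_liminf_expRate {p : ℕ → ℝ≥0∞} {a : ℝ} {N : ℝ≥0∞} (hN : N ≠ ∞)
    (h : ∀ n : ℕ, 0 < n → p n ≤ N * ENNReal.ofReal (Real.exp (-(n * a)))) :
    (a : EReal) ≤ liminf (fun n => expRate n (p n)) atTop := by
  set M : ℝ := N.toReal + 1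
  have hM : 0 < M := by positivity
  have hlim : Tendsto (fun n : ℕ => ((a - Real.log M / n : ℝ) : EReal)) atTop (𝓝 a) := by
    have h1 := (tendsto_const_div_atTop_nhds_zero_nat (Real.log M)).const_sub a
    rw [sub_zero] at h1
    exact (continuous_coe_real_ereal.tendsto a).comp h1
  rw [← hlim.liminf_eq]
  refine liminf_le_liminf ?_
  filter_upwards [eventually_gt_atTop 0] with n hn
  have hn' : (n : ℝ) ≠ 0 := by exact_mod_cast hn.ne'
  have hp : p n ≤ ENNReal.ofReal (M * Real.exp (-(n * a))) := by
    rw [ENNReal.ofReal_mul hM.le]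
    refine (h n hn).trans ?_
    gcongr
    exact ENNReal.le_ofReal_iff_toReal_le hN hM.le |>.2 (by simp [M])
  refine le_trans (le_of_eq ?_) (expRate_antitone n hp)
  rw [expRate_ofReal n (by positivity), Real.log_mul hM.ne' (Real.exp_ne_zero _), Real.log_exp]
  congr 1
  field_simp
  ring

end Rate

section UpperBound

variable {X : Type*} [MeasurableSpace X] [TopologicalSpace X] [BorelSpace X] [Nonempty X]

/-- The empirical measures of an i.i.d. sample are exponentially tight. -/
lemma exists_isCompact_measure_empMeas_notMem_le [PolishSpace X] (Q : Measure X)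
    [IsProbabilityMeasure Q] {a : ℝ} (ha : 0 ≤ a) :
    ∃ K : Set (ProbabilityMeasure X), IsCompact K ∧ ∃ N : ℝ≥0∞, N ≠ ∞ ∧ ∀ n : ℕ, 0 < n →
      Measure.pi (fun _ : Fin n => Q) {x | empMeas n x ∉ K}
        ≤ N * ENNReal.ofReal (Real.exp (-(n * a))) := by
  set t : ℕ → ℝ := fun j => (j + 1) * (a + 1 + j)
  have ht (j : ℕ) : 0 ≤ t j := by positivity
  have htight : IsTightMeasureSet {Q} := isTightMeasureSet_singleton
  rw [isTightMeasureSet_iff_exists_isCompact_measure_compl_le] at htight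
  choose K hK hQK using fun j : ℕ => htight (ENNReal.ofReal (Real.exp (-t j)))
    (by simpa using Real.exp_pos _)
  set u : ℕ → NNReal := fun j => Real.toNNReal (1 / ((j : ℝ) + 1))
  have hu : Tendsto u atTop (𝓝 0) := by
    have h := tendsto_real_toNNReal (tendsto_one_div_add_atTop_nhds_zero_nat (𝕜 := ℝ))
    rwa [Real.toNNReal_zero] at h
  refine ⟨{μ | ∀ j, μ (K j)ᶜ ≤ u j},
    isCompact_setOfPred_probabilityMeasure_mass_eq_compl_isCompact_le hu hK (.inl inferInstance),
    ∑' j : ℕ, ENNReal.ofReal (Real.exp (-j)), Real.summable_exp_neg_nat.tsum_ofReal_ne_top,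
    fun n hn => ?_⟩
  have hn1 : (1 : ℝ) ≤ n := by exact_mod_cast hn
  have hKm (j : ℕ) : MeasurableSet (K j)ᶜ := (hK j).isClosed.measurableSet.compl
  have hsub : {x : Fin n → X | empMeas n x ∉ {μ : ProbabilityMeasure X | ∀ j, μ (K j)ᶜ ≤ u j}}
      ⊆ ⋃ j : ℕ, {x | a + 1 + j
        ≤ ∫ y, (K j)ᶜ.indicator (fun _ => t j) y ∂(empMeas n x : Measure X)} := by
    intro x hx
    simp only [Set.mem_ofPred_eq, not_forall, not_le] at hx
    obtain ⟨j, hj⟩ := hx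
    refine Set.mem_iUnion.2 ⟨j, ?_⟩
    rw [Set.mem_ofPred_eq, integral_indicator_const _ (hKm j), smul_eq_mul]
    have hj' : 1 / ((j : ℝ) + 1) ≤ (empMeas n x : Measure X).real (K j)ᶜ :=
      (Real.toNNReal_le_iff_le_coe.1 hj.le)
    calc a + 1 + j = 1 / ((j : ℝ) + 1) * t j := by
          simp only [t]
          field_simp
      _ ≤ _ := mul_le_mul_of_nonneg_right hj' (ht j)
  refine (measure_mono hsub).trans ((measure_iUnion_le _).trans ?_)
  rw [← ENNReal.tsum_mul_right]
  refine ENNReal.tsum_le_tsum fun j => ?_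
  refine (measure_le_integral_empMeas Q (measurable_const.indicator (hKm j)) (B := t j)
    (fun x => Set.indicator_apply_le' (fun _ => le_rfl) fun _ => ht j) hn _).trans ?_
  rw [← ENNReal.ofReal_mul (Real.exp_nonneg _)]
  refine ENNReal.ofReal_le_ofReal ?_
  have hexp : ∫ y, Real.exp ((K j)ᶜ.indicator (fun _ => t j) y) ∂Q ≤ Real.exp 1 := by
    have hle (y : X) : Real.exp ((K j)ᶜ.indicator (fun _ => t j) y)
        ≤ 1 + (K j)ᶜ.indicator (fun _ => Real.exp (t j)) y := by
      by_cases hy : y ∈ (K j)ᶜ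
      · simp only [Set.indicator_of_mem hy]
        linarith
      · simp [Set.indicator_of_notMem hy]
    have hind : Integrable ((K j)ᶜ.indicator fun _ => Real.exp (t j)) Q :=
      (integrable_const _).indicator (hKm j)
    have hreal : Q.real (K j)ᶜ ≤ Real.exp (-t j) :=
      ENNReal.toReal_le_of_le_ofReal (Real.exp_nonneg _) (hQK j Q rfl)
    calc ∫ y, Real.exp ((K j)ᶜ.indicator (fun _ => t j) y) ∂Q
        ≤ ∫ y, (1 + (K j)ᶜ.indicator (fun _ => Real.exp (t j)) y) ∂Q :=
          integral_mono_of_nonneg (.of_forall fun _ => Real.exp_nonneg _)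
            ((integrable_const _).add hind) (.of_forall hle)
      _ = 1 + Q.real (K j)ᶜ * Real.exp (t j) := by
          rw [integral_add (integrable_const _) hind, integral_indicator_const _ (hKm j)]
          simp
      _ ≤ 1 + Real.exp (-t j) * Real.exp (t j) := by gcongr
      _ = 1 + 1 := by rw [← Real.exp_add, neg_add_cancel, Real.exp_zero]
      _ ≤ Real.exp 1 := Real.add_one_le_exp 1
  calc Real.exp (-(n * (a + 1 + j)))
        * (∫ y, Real.exp ((K j)ᶜ.indicator (fun _ => t j) y) ∂Q) ^ n
      ≤ Real.exp (-(n * (a + 1 + j))) * Real.exp 1 ^ n := by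
        gcongr
    _ = Real.exp (-(n * j)) * Real.exp (-(n * a)) := by
        rw [← Real.exp_nat_mul, ← Real.exp_add, ← Real.exp_add]
        congr 1
        ring
    _ ≤ Real.exp (-j) * Real.exp (-(n * a)) := by
        gcongr
        exact le_mul_of_one_le_left j.cast_nonneg hn1

/-- Sanov's upper bound on a compact set of measures. -/
lemma IsCompact.exists_measure_empMeas_mem_le [TopologicalSpace.PseudoMetrizableSpace X]
    (Q : Measure X) [IsProbabilityMeasure Q] {a : ℝ} {C : Set (ProbabilityMeasure X)}
    (hC : IsCompact C) (h : ∀ ρ ∈ C, ENNReal.ofReal a < klDiv (ρ : Measure X) Q) :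
    ∃ N : ℝ≥0∞, N ≠ ∞ ∧ ∀ n : ℕ, 0 < n →
      Measure.pi (fun _ : Fin n => Q) {x | empMeas n x ∈ C}
        ≤ N * ENNReal.ofReal (Real.exp (-(n * a))) := by
  refine hC.induction_on (p := fun C => ∃ N : ℝ≥0∞, N ≠ ∞ ∧ ∀ n : ℕ, 0 < n →
      Measure.pi (fun _ : Fin n => Q) {x | empMeas n x ∈ C}
        ≤ N * ENNReal.ofReal (Real.exp (-(n * a)))) ⟨0, by simp⟩ ?_ ?_ fun ρ hρ => ?_
  · rintro S T hST ⟨N, hN, hT⟩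
    exact ⟨N, hN, fun n hn => le_trans (measure_mono fun x hx => hST hx) (hT n hn)⟩
  · rintro S T ⟨N, hN, hS⟩ ⟨N', hN', hT⟩
    refine ⟨N + N', by simp [hN, hN'], fun n hn => ?_⟩
    rw [add_mul]
    exact (measure_union_le {x | empMeas n x ∈ S} {x | empMeas n x ∈ T}).trans
      (add_le_add (hS n hn) (hT n hn))
  · obtain ⟨g, hg⟩ : ∃ g : BoundedContinuousFunction X ℝ,
        a + Real.log (∫ x, Real.exp (g x) ∂Q) < ∫ x, g x ∂(ρ : Measure X) := by
      by_contra! hcon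
      exact (h ρ hρ).not_ge (klDiv_le_of_forall_boundedContinuous hcon)
    set c := a + Real.log (∫ x, Real.exp (g x) ∂Q)
    refine ⟨{μ | c < ∫ x, g x ∂(μ : Measure X)}, mem_nhdsWithin_of_mem_nhds ?_, 1, by simp,
      fun n hn => ?_⟩
    · exact (ProbabilityMeasure.tendsto_iff_forall_integral_tendsto.1 tendsto_id g).eventually_const_lt
        hg
    · have hB (x : X) : g x ≤ ‖g‖ := (le_abs_self _).trans (g.norm_coe_le_norm x)
      have hexp : Integrable (fun x => Real.exp (g x)) Q := by
        refine .of_bound (Continuous.aestronglyMeasurable (by fun_prop)) (Real.exp ‖g‖)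
          (.of_forall fun x => ?_)
        rw [Real.norm_eq_abs, Real.abs_exp]
        exact Real.exp_le_exp.2 (hB x)
      refine le_trans (measure_mono fun x hx => (show c < _ from hx).le)
        ((measure_le_integral_empMeas Q g.continuous.measurable hB hn c).trans (le_of_eq ?_))
      rw [one_mul, ← Real.exp_log (pow_pos (integral_exp_pos hexp) n), Real.log_pow,
        ← Real.exp_add]
      congr 2
      simp only [c]
      ring

end UpperBound

/-- Sanov's lower bound: a neighbourhood of `ρ` is charged at rate at most `D(ρ‖Q)`. -/
lemma limsup_expRate_empMeas_le_klDiv {X : Type*} [MeasurableSpace X] [TopologicalSpace X]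
    [OpensMeasurableSpace X] [Nonempty X] (Q : Measure X) [IsProbabilityMeasure Q]
    {Γ : Set (ProbabilityMeasure X)} {ρ : ProbabilityMeasure X} (hρ : Γ ∈ 𝓝 ρ) :
    limsup (fun n : ℕ => expRate n
      (Measure.pi (fun _ : Fin n => Q) {x | empMeas n x ∈ Γ})) atTop
      ≤ (klDiv (ρ : Measure X) Q : EReal) := by
  rw [klDiv_eq_informationTheory_klDiv]
  by_cases htop : InformationTheory.klDiv (ρ : Measure X) Q = ∞
  · simp [htop]
  set D := (InformationTheory.klDiv (ρ : Measure X) Q).toReal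
  set p : ℕ → ℝ := fun n =>
    (Measure.pi fun _ : Fin n => (ρ : Measure X)).real {x | empMeas n x ∈ Γ}
  have hp : Tendsto p atTop (𝓝 1) := by
    have h0 := (ENNReal.tendsto_toReal ENNReal.zero_ne_top).comp
      (tendsto_measure_empMeas_notMem ρ hρ)
    have h1 := h0.const_sub 1
    rw [ENNReal.toReal_zero, sub_zero] at h1
    refine tendsto_of_tendsto_of_tendsto_of_le_of_le h1 tendsto_const_nhds (fun n => ?_)
      fun n => measureReal_le_one
    have h2 := measureReal_union_le (μ := Measure.pi fun _ : Fin n => (ρ : Measure X))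
      {x | empMeas n x ∈ Γ} {x | empMeas n x ∈ Γ}ᶜ
    rw [Set.union_compl_self, probReal_univ] at h2
    exact sub_le_iff_le_add.2 h2
  have hlim : Tendsto (fun n : ℕ => (((D + 1 / n) / p n : ℝ) : EReal)) atTop (𝓝 D) := by
    have h1 := ((tendsto_const_div_atTop_nhds_zero_nat (1 : ℝ)).const_add D).div hp one_ne_zero
    rw [add_zero, div_one] at h1
    exact (continuous_coe_real_ereal.tendsto D).comp h1
  rw [← EReal.coe_ennreal_toReal htop, ← hlim.limsup_eq]
  refine limsup_le_limsup ?_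
  filter_upwards [eventually_gt_atTop 0, hp.eventually_const_lt one_pos] with n hn hpn
  have hn' : (0 : ℝ) < n := by exact_mod_cast hn
  have hpi := informationTheory_klDiv_pi_le (ρ : Measure X) Q n
  have hpitop : n * InformationTheory.klDiv (ρ : Measure X) Q ≠ ∞ :=
    ENNReal.mul_ne_top (ENNReal.natCast_ne_top n) htop
  obtain ⟨hq, hlog⟩ := pos_and_neg_log_le_of_klDiv_ne_top (ne_top_of_le_ne_top hpitop hpi) hpn
  have hD := ENNReal.toReal_mono hpitop hpi
  rw [ENNReal.toReal_mul, ENNReal.toReal_natCast] at hD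
  rw [← ofReal_measureReal, expRate_ofReal n hq, EReal.coe_le_coe_iff, div_le_iff₀ hn']
  refine hlog.trans ?_
  rw [div_mul_eq_mul_div]
  refine div_le_div_of_nonneg_right ?_ hpn.le
  rw [add_mul, one_div, inv_mul_cancel₀ hn'.ne', mul_comm]
  gcongr

/-- **Sanov's theorem.** For i.i.d. samples from `Q` on a Polish space, with empirical measures
`Q̂_n`, and any set `Γ` of probability measures,
`limsup -(1/n) log P(Q̂_n ∈ Γ) ≤ inf_{R ∈ int Γ} D(R‖Q)` and
`liminf -(1/n) log P(Q̂_n ∈ Γ) ≥ inf_{R ∈ cl Γ} D(R‖Q)`, where interior and closure are with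
respect to the topology of weak convergence. -/
theorem sanov_theorem {X : Type*} [MeasurableSpace X] [TopologicalSpace X]
    [PolishSpace X] [BorelSpace X] [Nonempty X]
    (Q : Measure X) [IsProbabilityMeasure Q] (Γ : Set (ProbabilityMeasure X)) :
    limsup (fun n : ℕ => expRate n
        (Measure.pi (fun _ : Fin n => Q) {x | empMeas n x ∈ Γ})) atTop
      ≤ ((⨅ R ∈ interior Γ, klDiv (R : Measure X) Q : ℝ≥0∞) : EReal)
    ∧ ((⨅ R ∈ closure Γ, klDiv (R : Measure X) Q : ℝ≥0∞) : EReal)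
      ≤ liminf (fun n : ℕ => expRate n
        (Measure.pi (fun _ : Fin n => Q) {x | empMeas n x ∈ Γ})) atTop := by
  constructor
  · set L := limsup (fun n : ℕ => expRate n
      (Measure.pi (fun _ : Fin n => Q) {x | empMeas n x ∈ Γ})) atTop
    refine ((le_max_right 0 L).trans_eq EReal.coe_toENNReal_eq_max.symm).trans
      (EReal.coe_ennreal_le_coe_ennreal_iff.2 ?_)
    refine le_iInf₂ fun R hR => ?_
    rw [← EReal.toENNReal_coe (x := klDiv (R : Measure X) Q)]
    exact EReal.toENNReal_le_toENNReal
      (limsup_expRate_empMeas_le_klDiv Q (mem_interior_iff_mem_nhds.1 hR))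
  · refine EReal.ge_of_forall_gt_iff_ge.1 fun a ha => ?_
    rcases lt_or_ge a 0 with ha0 | ha0
    · refine le_liminf_expRate (N := 1) (by simp) fun n _ => prob_le_one.trans ?_
      rw [one_mul, ENNReal.one_le_ofReal, Real.one_le_exp_iff, neg_nonneg]
      exact mul_nonpos_of_nonneg_of_nonpos n.cast_nonneg ha0.le
    · have hcoe : ((ENNReal.ofReal a : ℝ≥0∞) : EReal) = a := by
        rw [EReal.coe_ennreal_ofReal, max_eq_left ha0]
      rw [← hcoe, EReal.coe_ennreal_lt_coe_ennreal_iff] at ha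
      have hΓ (R : ProbabilityMeasure X) (hR : R ∈ closure Γ) :
          ENNReal.ofReal a < klDiv (R : Measure X) Q := ha.trans_le (iInf₂_le R hR)
      obtain ⟨K, hK, N, hN, hKN⟩ := exists_isCompact_measure_empMeas_notMem_le Q ha0
      obtain ⟨N', hN', hCN⟩ := (hK.inter_left (isClosed_closure (s := Γ)))
        |>.exists_measure_empMeas_mem_le Q fun R hR => hΓ R hR.1
      refine le_liminf_expRate (N := N' + N) (by simp [hN, hN']) fun n hn => ?_
      rw [add_mul]
      refine le_trans (measure_mono fun x hx => ?_)
        ((measure_union_le _ _).trans (add_le_add (hCN n hn) (hKN n hn)))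
      by_cases hxK : empMeas n x ∈ K
      · exact .inl ⟨subset_closure hx, hxK⟩
      · exact .inr hxK
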